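/- arXiv:1308.6411 — 10 statements merged into one kernel-verified Lean document; each statement's English description precedes it below -/
import Mathlib

section
/- Let a, b, k be integers with |a| > 1, |b| > 1, |k·a + b| > 1 and gcd(a,b) = 1. Let x = (a⁻¹)_b and y = (b⁻¹)_a. Then the integer z = k·(a − y) + x is the modular inverse (a⁻¹)_{k·a+b}; that is, a·z ≡ 1 (mod k·a + b) and 1 ≤ z ≤ k·a+b−1 if k·a+b > 1, respectively k·a+b+1 ≤ z ≤ −1 if k·a+b < −1. -/
/-- Reduced mutual inverses of coprime integers `a`, `b` satisfy `a x + b y = 1 + a b`. -/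
theorem mul_inverse_add_mul_inverse {a b x y : ℤ} (ha : 1 < |a|) (hb : 1 < |b|)
    (hab : Int.gcd a b = 1) (hx : a * x ≡ 1 [ZMOD b])
    (hxb : (1 < b → 1 ≤ x ∧ x ≤ b - 1) ∧ (b < -1 → b + 1 ≤ x ∧ x ≤ -1))
    (hy : b * y ≡ 1 [ZMOD a])
    (hya : (1 < a → 1 ≤ y ∧ y ≤ a - 1) ∧ (a < -1 → a + 1 ≤ y ∧ y ≤ -1)) :
    a * x + b * y = 1 + a * b := by
  have hda : a ∣ a * x + b * y - 1 := by
    rw [add_sub_assoc]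
    exact dvd_add (dvd_mul_right a x) hy.symm.dvd
  have hdb : b ∣ a * x + b * y - 1 := by
    rw [add_sub_right_comm]
    exact dvd_add hx.symm.dvd (dvd_mul_right b y)
  obtain ⟨q, hq⟩ := (Int.isCoprime_iff_gcd_eq_one.mpr hab).mul_dvd hda hdb
  suffices q = 1 by
    subst this
    linarith
  suffices 0 < q ∧ q < 2 by omega
  rcases lt_abs.mp ha with ha | ha <;> rcases lt_abs.mp hb with hb | hb
  · obtain ⟨hx1, hx2⟩ := hxb.1 hb
    obtain ⟨hy1, hy2⟩ := hya.1 ha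
    have hpos : 0 < a * b := by nlinarith
    constructor <;> refine lt_of_mul_lt_mul_left ?_ hpos.le <;> nlinarith
  · obtain ⟨hx1, hx2⟩ := hxb.2 (by linarith)
    obtain ⟨hy1, hy2⟩ := hya.1 ha
    have hneg : 0 < -(a * b) := by nlinarith
    constructor <;> refine lt_of_mul_lt_mul_left ?_ hneg.le <;> nlinarith
  · obtain ⟨hx1, hx2⟩ := hxb.1 hb
    obtain ⟨hy1, hy2⟩ := hya.2 (by linarith)
    have hneg : 0 < -(a * b) := by nlinarith
    constructor <;> refine lt_of_mul_lt_mul_left ?_ hneg.le <;> nlinarith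
  · obtain ⟨hx1, hx2⟩ := hxb.2 (by linarith)
    obtain ⟨hy1, hy2⟩ := hya.2 (by linarith)
    have hpos : 0 < a * b := by nlinarith
    constructor <;> refine lt_of_mul_lt_mul_left ?_ hpos.le <;> nlinarith

/-- If `|a| > 1`, `|b| > 1`, `|k·a + b| > 1`, `gcd(a,b) = 1`, `x = (a⁻¹)_b`, `y = (b⁻¹)_a`,
then `z = k·(a − y) + x` is the modular inverse `(a⁻¹)_{k·a+b}`. -/
theorem inverse_mod_shifted_modulus (a b k x y : ℤ)
    (ha : 1 < |a|) (hb : 1 < |b|) (hm : 1 < |k * a + b|) (hab : Int.gcd a b = 1)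
    (hx : a * x ≡ 1 [ZMOD b])
    (hxb : (1 < b → 1 ≤ x ∧ x ≤ b - 1) ∧ (b < -1 → b + 1 ≤ x ∧ x ≤ -1))
    (hy : b * y ≡ 1 [ZMOD a])
    (hya : (1 < a → 1 ≤ y ∧ y ≤ a - 1) ∧ (a < -1 → a + 1 ≤ y ∧ y ≤ -1)) :
    a * (k * (a - y) + x) ≡ 1 [ZMOD (k * a + b)] ∧
      (1 < k * a + b →
        1 ≤ k * (a - y) + x ∧ k * (a - y) + x ≤ k * a + b - 1) ∧
      (k * a + b < -1 →
        k * a + b + 1 ≤ k * (a - y) + x ∧ k * (a - y) + x ≤ -1) := by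
  have hz : a * (k * (a - y) + x) = 1 + (a - y) * (k * a + b) := by
    linear_combination mul_inverse_add_mul_inverse ha hb hab hx hxb hy hya
  refine ⟨(Int.modEq_iff_dvd.mpr ⟨a - y, by rw [hz]; ring⟩).symm, ?_⟩
  generalize k * (a - y) + x = z at hz ⊢
  generalize k * a + b = m at hz ⊢
  rcases lt_abs.mp ha with ha | ha
  · obtain ⟨hy1, hy2⟩ := hya.1 ha
    refine ⟨fun h => ?_, fun h => ?_⟩
    · have h1 : 0 < z := lt_of_mul_lt_mul_left (by nlinarith) (by linarith : 0 ≤ a)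
      have h2 : z < m := lt_of_mul_lt_mul_left (by nlinarith) (by linarith : 0 ≤ a)
      omega
    · have h1 : z < 0 := lt_of_mul_lt_mul_left (by nlinarith) (by linarith : 0 ≤ a)
      have h2 : m < z := lt_of_mul_lt_mul_left (by nlinarith) (by linarith : 0 ≤ a)
      omega
  · obtain ⟨hy1, hy2⟩ := hya.2 (by linarith)
    refine ⟨fun h => ?_, fun h => ?_⟩
    · have h1 : 0 < z := lt_of_mul_lt_mul_left (by nlinarith) (by linarith : 0 ≤ -a)
      have h2 : z < m := lt_of_mul_lt_mul_left (by nlinarith) (by linarith : 0 ≤ -a)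
      omega
    · have h1 : z < 0 := lt_of_mul_lt_mul_left (by nlinarith) (by linarith : 0 ≤ -a)
      have h2 : m < z := lt_of_mul_lt_mul_left (by nlinarith) (by linarith : 0 ≤ -a)
      omega
end

section
/- Let a, b, k be integers with |a| > 1, |b| > 1, |k·a − b| > 1 and gcd(a,b) = 1. Let x = (a⁻¹)_b and y = (b⁻¹)_a. Then the integer z = k·y − (b − x) is the modular inverse (a⁻¹)_{k·a−b}; that is, a·z ≡ 1 (mod k·a − b) and 1 ≤ z ≤ k·a−b−1 if k·a−b > 1, respectively k·a−b+1 ≤ z ≤ −1 if k·a−b < −1. -/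
/-- The residues `x = (a⁻¹)_b` and `y = (b⁻¹)_a` satisfy `a·x + b·y = 1 + a·b`. -/
theorem mul_inverse_add_mul_inverse_eq (a b x y : ℤ)
    (ha : 1 < |a|) (hb : 1 < |b|) (hab : Int.gcd a b = 1)
    (hx : a * x ≡ 1 [ZMOD b])
    (hxb : (1 < b → 1 ≤ x ∧ x ≤ b - 1) ∧ (b < -1 → b + 1 ≤ x ∧ x ≤ -1))
    (hy : b * y ≡ 1 [ZMOD a])
    (hya : (1 < a → 1 ≤ y ∧ y ≤ a - 1) ∧ (a < -1 → a + 1 ≤ y ∧ y ≤ -1)) :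
    a * x + b * y = 1 + a * b := by
  have hda : a ∣ a * x + b * y - 1 := by
    rw [add_sub_assoc]
    exact dvd_add (dvd_mul_right a x) hy.symm.dvd
  have hdb : b ∣ a * x + b * y - 1 := by
    rw [add_sub_right_comm]
    exact dvd_add hx.symm.dvd (dvd_mul_right b y)
  obtain ⟨t, ht⟩ := (Int.isCoprime_iff_gcd_eq_one.mpr hab).mul_dvd hda hdb
  suffices t = 1 by
    subst this
    linarith
  rcases lt_abs.mp ha with ha | ha <;> rcases lt_abs.mp hb with hb | hb
  · obtain ⟨hx1, hx2⟩ := hxb.1 hb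
    obtain ⟨hy1, hy2⟩ := hya.1 ha
    have hpos : 0 < a * b := by nlinarith
    have h0 : 0 < t := by
      apply pos_of_mul_pos_right _ hpos.le
      nlinarith
    have h2 : t < 2 := by
      apply lt_of_mul_lt_mul_left _ hpos.le
      nlinarith
    lia
  · obtain ⟨hx1, hx2⟩ := hxb.2 (by lia)
    obtain ⟨hy1, hy2⟩ := hya.1 ha
    have hpos : 0 < a * -b := by nlinarith
    have h0 : 0 < t := by
      apply pos_of_mul_pos_right _ hpos.le
      nlinarith
    have h2 : t < 2 := by
      apply lt_of_mul_lt_mul_left _ hpos.le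
      nlinarith
    lia
  · obtain ⟨hx1, hx2⟩ := hxb.1 hb
    obtain ⟨hy1, hy2⟩ := hya.2 (by lia)
    have hpos : 0 < -a * b := by nlinarith
    have h0 : 0 < t := by
      apply pos_of_mul_pos_right _ hpos.le
      nlinarith
    have h2 : t < 2 := by
      apply lt_of_mul_lt_mul_left _ hpos.le
      nlinarith
    lia
  · obtain ⟨hx1, hx2⟩ := hxb.2 (by lia)
    obtain ⟨hy1, hy2⟩ := hya.2 (by lia)
    have hpos : 0 < a * b := by nlinarith
    have h0 : 0 < t := by
      apply pos_of_mul_pos_right _ hpos.le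
      nlinarith
    have h2 : t < 2 := by
      apply lt_of_mul_lt_mul_left _ hpos.le
      nlinarith
    lia

/-- If `|a| > 1`, `|b| > 1`, `|k·a − b| > 1`, `gcd(a,b) = 1`, `x = (a⁻¹)_b`, `y = (b⁻¹)_a`,
then `z = k·y − (b − x)` is the modular inverse `(a⁻¹)_{k·a−b}`. -/
theorem inverse_mod_shifted_modulus_sub (a b k x y : ℤ)
    (ha : 1 < |a|) (hb : 1 < |b|) (hm : 1 < |k * a - b|) (hab : Int.gcd a b = 1)
    (hx : a * x ≡ 1 [ZMOD b])
    (hxb : (1 < b → 1 ≤ x ∧ x ≤ b - 1) ∧ (b < -1 → b + 1 ≤ x ∧ x ≤ -1))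
    (hy : b * y ≡ 1 [ZMOD a])
    (hya : (1 < a → 1 ≤ y ∧ y ≤ a - 1) ∧ (a < -1 → a + 1 ≤ y ∧ y ≤ -1)) :
    a * (k * y - (b - x)) ≡ 1 [ZMOD (k * a - b)] ∧
      (1 < k * a - b →
        1 ≤ k * y - (b - x) ∧ k * y - (b - x) ≤ k * a - b - 1) ∧
      (k * a - b < -1 →
        k * a - b + 1 ≤ k * y - (b - x) ∧ k * y - (b - x) ≤ -1) := by
  have key := mul_inverse_add_mul_inverse_eq a b x y ha hb hab hx hxb hy hya
  have hz : a * (k * y - (b - x)) = 1 + (k * a - b) * y := by linear_combination key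
  generalize k * y - (b - x) = z at *
  generalize k * a - b = m at *
  refine ⟨?_, fun hm => ?_, fun hm => ?_⟩
  · rw [hz]
    exact Int.modEq_iff_dvd.mpr ⟨-y, by ring⟩
  all_goals
    rcases lt_abs.mp ha with ha | ha
    · obtain ⟨hy1, hy2⟩ := hya.1 ha
      constructor <;> by_contra! <;> nlinarith
    · obtain ⟨hy1, hy2⟩ := hya.2 (by lia)
      constructor <;> by_contra! <;> nlinarith
end

section
/- Reciprocity formula for the extended modular inverse (case s = 1): let p, q, a be integers with 1 < q < p, 0 ≤ a < p and gcd(p,q) = 1. Let r = (p)_q and γ = (−a)_q, and let w be the unique integer with 0 ≤ w < q and r·w ≡ γ (mod q). Then q divides a + p·w, and the integer x = (a + p·w)/q satisfies 0 ≤ x < p and q·x ≡ a (mod p); that is, (a(q⁻¹)_p)_p = a/q + (p/q)·(γ(r⁻¹)_q)_q. -/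
/-- Reciprocity formula for the extended modular inverse, case `s = 1`.  With `r = (p)_q`,
`γ = (−a)_q` and `w` the unique representative in `[0,q)` of `γ·r⁻¹` mod `q`, the integer
`x = (a + p·w)/q` is the extended modular inverse `(a(q⁻¹)_p)_p`. -/
theorem ext_inverse_reciprocity_pos (p q a w : ℤ)
    (hq : 1 < q) (hp : q < p) (ha0 : 0 ≤ a) (hap : a < p) (hpq : Int.gcd p q = 1)
    (hw0 : 0 ≤ w) (hwq : w < q)
    (hw : (p % q) * w ≡ (-a) % q [ZMOD q]) :
    q ∣ (a + p * w) ∧ 0 ≤ (a + p * w) / q ∧ (a + p * w) / q < p ∧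
      q * ((a + p * w) / q) ≡ a [ZMOD p] := by
  have hdvd : q ∣ a + p * w := by
    have h : p * w ≡ -a [ZMOD q] :=
      ((Int.mod_modEq p q).symm.mul_right w).trans (hw.trans (Int.mod_modEq (-a) q))
    simpa [add_comm] using h.symm.dvd
  obtain ⟨x, hx⟩ := hdvd
  have hq0 : 0 < q := by lia
  rw [hx, Int.mul_ediv_cancel_left x hq0.ne']
  have hpw : 0 ≤ p * w := mul_nonneg (by lia) hw0
  refine ⟨dvd_mul_right q x, ?_, ?_, ?_⟩
  · exact nonneg_of_mul_nonneg_right (by lia : 0 ≤ q * x) hq0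
  · refine lt_of_mul_lt_mul_left ?_ hq0.le
    have : p * w ≤ p * (q - 1) := mul_le_mul_of_nonneg_left (by lia) (by lia)
    linarith
  · rw [← hx]
    simp [Int.ModEq]
end

section
/- Reciprocity formula for the extended modular inverse (case s = −1): let p, q, a be integers with 1 < q < p, 0 ≤ a < p and gcd(p,q) = 1. Let r = (−p)_q and γ = (a)_q, and let w be the unique integer with 0 ≤ w < q and r·w ≡ γ (mod q). Then q divides a + p·w, and the integer x = (a + p·w)/q satisfies 0 ≤ x < p and q·x ≡ a (mod p); that is, (a(q⁻¹)_p)_p = a/q + (p/q)·(γ(r⁻¹)_q)_q. -/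
/-- Reciprocity formula for the extended modular inverse, case `s = −1`.  With `r = (−p)_q`,
`γ = (a)_q` and `w` the unique representative in `[0,q)` of `γ·r⁻¹` mod `q`, the integer
`x = (a + p·w)/q` is the extended modular inverse `(a(q⁻¹)_p)_p`. -/
theorem ext_inverse_reciprocity_neg (p q a w : ℤ)
    (hq : 1 < q) (hp : q < p) (ha0 : 0 ≤ a) (hap : a < p) (hpq : Int.gcd p q = 1)
    (hw0 : 0 ≤ w) (hwq : w < q)
    (hw : ((-p) % q) * w ≡ a % q [ZMOD q]) :
    q ∣ (a + p * w) ∧ 0 ≤ (a + p * w) / q ∧ (a + p * w) / q < p ∧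
      q * ((a + p * w) / q) ≡ a [ZMOD p] := by
  have hmod : -p * w ≡ a [ZMOD q] :=
    ((Int.mod_modEq (-p) q).mul_right w).symm.trans (hw.trans (Int.mod_modEq a q))
  have hdvd : q ∣ a + p * w := by
    have h := hmod.dvd
    rwa [neg_mul, sub_neg_eq_add] at h
  have hq0 : 0 < q := by lia
  have hp0 : 0 < p := by lia
  refine ⟨hdvd, Int.ediv_nonneg (by positivity) hq0.le, ?_, ?_⟩
  · rw [Int.ediv_lt_iff_lt_mul hq0]
    nlinarith [mul_le_mul_of_nonneg_left (Int.add_one_le_of_lt hwq) hp0.le]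
  · rw [Int.mul_ediv_cancel' hdvd]
    exact Int.add_mul_emod_self_left a p w
end

section
/- Non-coprime reciprocity: let p, q, a be integers with 1 < q < p, 0 ≤ a < p, d = gcd(p,q), and d ∣ a. Let r = (p)_q and γ = (−a)_q. Then d ∣ r and d ∣ γ, and letting w be the unique integer with 0 ≤ w < q/d and (r/d)·w ≡ γ/d (mod q/d), q divides a + p·w and the integer x = (a + p·w)/q satisfies 0 ≤ x < p/d and (q/d)·x ≡ a/d (mod p/d). -/
/-- Non-coprime reciprocity for the extended modular inverse: with `d = gcd(p,q)`, `d ∣ a`,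
`r = (p)_q`, `γ = (−a)_q`, one has `d ∣ r`, `d ∣ γ`, and for the unique `w` in `[0, q/d)`
with `(r/d)·w ≡ γ/d (mod q/d)`, the integer `x = (a + p·w)/q` satisfies `0 ≤ x < p/d` and
`(q/d)·x ≡ a/d (mod p/d)`. -/
theorem ext_inverse_reciprocity_noncoprime (p q a : ℤ)
    (hq : 1 < q) (hp : q < p) (ha0 : 0 ≤ a) (hap : a < p)
    (hd : (Int.gcd p q : ℤ) ∣ a) :
    (Int.gcd p q : ℤ) ∣ p % q ∧ (Int.gcd p q : ℤ) ∣ (-a) % q ∧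
      ∀ w : ℤ, 0 ≤ w → w < q / (Int.gcd p q : ℤ) →
        ((p % q) / (Int.gcd p q : ℤ)) * w ≡ ((-a) % q) / (Int.gcd p q : ℤ)
          [ZMOD (q / (Int.gcd p q : ℤ))] →
        q ∣ (a + p * w) ∧ 0 ≤ (a + p * w) / q ∧
          (a + p * w) / q < p / (Int.gcd p q : ℤ) ∧
          (q / (Int.gcd p q : ℤ)) * ((a + p * w) / q) ≡ a / (Int.gcd p q : ℤ)
            [ZMOD (p / (Int.gcd p q : ℤ))] := by
  have hd0 : (0 : ℤ) < Int.gcd p q := by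
    exact_mod_cast Int.gcd_pos_of_ne_zero_right p (by omega)
  have hdp : (Int.gcd p q : ℤ) ∣ p := Int.gcd_dvd_left p q
  have hdq : (Int.gcd p q : ℤ) ∣ q := Int.gcd_dvd_right p q
  generalize (Int.gcd p q : ℤ) = d at *
  obtain ⟨P, rfl⟩ := hdp
  obtain ⟨Q, rfl⟩ := hdq
  obtain ⟨A, rfl⟩ := hd
  have hQ : 0 < Q := pos_of_mul_pos_right (by omega) hd0.le
  have hA0 : 0 ≤ A := nonneg_of_mul_nonneg_right ha0 hd0
  have hAP : A < P := lt_of_mul_lt_mul_left hap hd0.le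
  have hP : d * P % (d * Q) = d * (P % Q) := Int.mul_emod_mul_of_pos P Q hd0
  have hA : -(d * A) % (d * Q) = d * (-A % Q) := by
    rw [← mul_neg, Int.mul_emod_mul_of_pos _ _ hd0]
  simp only [hP, hA, Int.mul_ediv_cancel_left _ hd0.ne']
  refine ⟨dvd_mul_right _ _, dvd_mul_right _ _, fun w hw0 hwQ hw => ?_⟩
  have hmod : P * w ≡ -A [ZMOD Q] :=
    ((Int.mod_modEq P Q).symm.mul_right w).trans (hw.trans (Int.mod_modEq (-A) Q))
  obtain ⟨k, hk⟩ : Q ∣ A + P * w := by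
    have h := hmod.symm.dvd
    rwa [sub_neg_eq_add, add_comm] at h
  have hk' : d * A + d * P * w = d * Q * k := by linear_combination d * hk
  rw [hk', Int.mul_ediv_cancel_left _ (by positivity)]
  refine ⟨dvd_mul_right _ _, ?_, ?_, ?_⟩
  · have hPw : 0 ≤ P * w := mul_nonneg (by omega) hw0
    exact nonneg_of_mul_nonneg_right (by omega : 0 ≤ Q * k) hQ
  · refine lt_of_mul_lt_mul_left (?_ : Q * k < Q * P) hQ.le
    nlinarith [mul_le_mul_of_nonneg_left (show w ≤ Q - 1 by omega) (show 0 ≤ P by omega)]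
  · rw [← hk]
    exact Int.add_mul_emod_self_left A P w
end

section
/- Extended Modular Inverse Formula (fraction form): let p, q, a be integers with 1 < q < p, 0 ≤ a < p and gcd(p,q) = 1. Suppose n ≥ 0 and there are integer sequences r_{−1}, r_0, …, r_{n+1}; γ_0, …, γ_{n+1}; c_1, …, c_{n+1}; β_0, …, β_n; s_1, …, s_{n+1} with each s_i ∈ {−1, 1}, such that r_{−1} = p, r_0 = q, γ_0 = a, and for every 0 ≤ i ≤ n: r_{i−1} = c_{i+1}·r_i + s_{i+1}·r_{i+1} with 0 ≤ r_{i+1} < r_i, and γ_i = β_i·r_i − s_{i+1}·γ_{i+1} with 0 ≤ γ_{i+1} < r_i. If r_n = 1 or γ_{n+1} = 0, then the extended modular inverse x = (a(q⁻¹)_p)_p satisfies, as rational numbers, x = Σ_{i=0}^{n} p·γ_i/(r_{i−1}·r_i). -/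
/-- The partial sums of the fraction expansion, taken from the tail, are the integers solving the
successive congruences `r 1 * X ≡ γ 0 [ZMOD r 0]` in the range `[0, r 0)`. -/
theorem exists_modEq_eq_sum_fractions (n : ℕ) (r γ c β s : ℕ → ℤ)
    (hγ : 0 ≤ γ 0) (hγr : γ 0 < r 0)
    (hrec : ∀ i < n, r i = c (i + 1) * r (i + 1) + s (i + 1) * r (i + 2))
    (hγrec : ∀ i < n, γ i = β i * r (i + 1) - s (i + 1) * γ (i + 1) ∧
      0 ≤ γ (i + 1) ∧ γ (i + 1) < r (i + 1))
    (hterm : r n = 1 ∨ γ n = 0) :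
    ∃ X : ℤ, 0 ≤ X ∧ X < r 0 ∧ r 0 ∣ r 1 * X - γ 0 ∧
      (X : ℚ) = ∑ i ∈ Finset.range n, (r 0 : ℚ) * (γ i : ℚ) / ((r i : ℚ) * (r (i + 1) : ℚ)) := by
  induction n generalizing r γ c β s with
  | zero =>
    refine ⟨0, le_rfl, by linarith, ?_, by simp⟩
    rcases hterm with h | h <;> simp [h]
  | succ n ih =>
    obtain ⟨hγ_eq, hγ1, hγr1⟩ := hγrec 0 n.succ_pos
    have hr_eq := hrec 0 n.succ_pos
    obtain ⟨Y, hY0, hYr, ⟨k, hk⟩, hYsum⟩ := ih (fun i => r (i + 1)) (fun i => γ (i + 1))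
      (fun i => c (i + 1)) (fun i => β (i + 1)) (fun i => s (i + 1)) hγ1 hγr1
      (fun i hi => hrec (i + 1) (by omega)) (fun i hi => hγrec (i + 1) (by omega)) hterm
    simp only [zero_add, Nat.reduceAdd] at *
    have hr1 : 0 < r 1 := by linarith
    have hr0 : 0 < r 0 := by linarith
    obtain ⟨X, hX⟩ : ∃ X, γ 0 + r 0 * Y = r 1 * X :=
      ⟨β 0 + c 1 * Y + s 1 * k, by linear_combination hγ_eq + Y * hr_eq + s 1 * hk⟩
    refine ⟨X, ?_, ?_, ⟨Y, by linarith⟩, ?_⟩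
    · nlinarith [mul_nonneg hr0.le hY0]
    · have : r 0 * Y ≤ r 0 * (r 1 - 1) := mul_le_mul_of_nonneg_left (by omega) hr0.le
      nlinarith
    · have hr0' : (r 0 : ℚ) ≠ 0 := by exact_mod_cast hr0.ne'
      have hr1' : (r 1 : ℚ) ≠ 0 := by exact_mod_cast hr1.ne'
      have hXq : (γ 0 : ℚ) + r 0 * Y = r 1 * X := by exact_mod_cast hX
      have htail : ∑ i ∈ Finset.range n,
          (r 0 : ℚ) * (γ (i + 1) : ℚ) / ((r (i + 1) : ℚ) * (r (i + 1 + 1) : ℚ))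
          = (r 0 : ℚ) / r 1 * Y := by
        rw [hYsum, Finset.mul_sum]
        refine Finset.sum_congr rfl fun i _ => ?_
        field_simp
      rw [Finset.sum_range_succ', htail]
      simp only [zero_add]
      field_simp
      linear_combination -hXq

/-- Extended Modular Inverse Formula, fraction form.  Indexing is shifted by one: the Lean
value `r j` is the paper's `r_{j-1}`, so `r 0 = r₋₁ = p`, `r 1 = r₀ = q`; `γ i`, `β i`,
`c i`, `s i` carry the paper's indices.  If the generalized division algorithm terminates
(`rₙ = 1` or `γₙ₊₁ = 0`), then the extended modular inverse `x = (a(q⁻¹)_p)_p` satisfies,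
in `ℚ`, `x = Σ_{i=0}^{n} p·γᵢ/(r_{i-1}·r_i)`. -/
theorem ext_inverse_fraction_formula (p q a : ℤ) (n : ℕ) (r γ c β s : ℕ → ℤ) (x : ℤ)
    (hq : 1 < q) (hp : q < p) (ha0 : 0 ≤ a) (hap : a < p) (hpq : Int.gcd p q = 1)
    (hs : ∀ i, 1 ≤ i → i ≤ n + 1 → s i = 1 ∨ s i = -1)
    (hr0 : r 0 = p) (hr1 : r 1 = q) (hγ0 : γ 0 = a)
    (hrec : ∀ i ≤ n, r i = c (i + 1) * r (i + 1) + s (i + 1) * r (i + 2) ∧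
      0 ≤ r (i + 2) ∧ r (i + 2) < r (i + 1))
    (hγrec : ∀ i ≤ n, γ i = β i * r (i + 1) - s (i + 1) * γ (i + 1) ∧
      0 ≤ γ (i + 1) ∧ γ (i + 1) < r (i + 1))
    (hterm : r (n + 1) = 1 ∨ γ (n + 1) = 0)
    (hx0 : 0 ≤ x) (hxp : x < p) (hx : q * x ≡ a [ZMOD p]) :
    (x : ℚ) = ∑ i ∈ Finset.range (n + 1), (p : ℚ) * (γ i : ℚ) / ((r i : ℚ) * (r (i + 1) : ℚ)) := by
  obtain ⟨X, hX0, hXr, hXdvd, hXsum⟩ := exists_modEq_eq_sum_fractions (n + 1) r γ c β s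
    (by rwa [hγ0]) (by rwa [hγ0, hr0]) (fun i hi => (hrec i (by omega)).1)
    (fun i hi => hγrec i (by omega)) hterm
  rw [hr0] at hXr hXdvd hXsum
  rw [hr1, hγ0] at hXdvd
  have hqX : q * X ≡ a [ZMOD p] := (Int.modEq_iff_dvd.mpr hXdvd).symm
  have hxX : x ≡ X [ZMOD p] := by
    have := Int.ModEq.cancel_left_div_gcd (by linarith) (hx.trans hqX.symm)
    rwa [hpq, Nat.cast_one, Int.ediv_one] at this
  have : x = X := by
    rw [Int.ModEq, Int.emod_eq_of_lt hx0 hxp, Int.emod_eq_of_lt hX0 hXr] at hxX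
    exact hxX
  rw [this, hXsum]
end

section
/- Extended Modular Inverse Formula (convergent form): let p, q, a be integers with 1 < q < p, 0 ≤ a < p and gcd(p,q) = 1. Suppose n ≥ 0 and there are integer sequences r_{−1}, r_0, …, r_{n+1}; γ_0, …, γ_{n+1}; c_1, …, c_{n+1}; β_0, …, β_n; s_1, …, s_{n+1} with each s_i ∈ {−1, 1}, such that r_{−1} = p, r_0 = q, γ_0 = a, and for every 0 ≤ i ≤ n: r_{i−1} = c_{i+1}·r_i + s_{i+1}·r_{i+1} with 0 ≤ r_{i+1} < r_i, and γ_i = β_i·r_i − s_{i+1}·γ_{i+1} with 0 ≤ γ_{i+1} < r_i. Define f_0 = 1, f_1 = c_1, and f_i = c_i·f_{i−1} + s_{i−1}·f_{i−2} for 2 ≤ i ≤ n. If r_n = 1 or γ_{n+1} = 0, then the extended modular inverse satisfies (a(q⁻¹)_p)_p = Σ_{i=0}^{n} f_i·β_i. -/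
/-- A second-order linear recurrence can be solved downwards from zero terminal values. -/
lemma exists_backward_recurrence (n : ℕ) (β c s : ℕ → ℤ) :
    ∃ A : ℕ → ℤ, A n = 0 ∧ A (n + 1) = 0 ∧
      ∀ i < n, A i = β i + c (i + 1) * A (i + 1) + s (i + 1) * A (i + 2) := by
  induction n generalizing β c s with
  | zero => exact ⟨0, rfl, rfl, by simp⟩
  | succ n ih =>
    obtain ⟨A, h0, h1, hA⟩ := ih (fun i => β (i + 1)) (fun i => c (i + 1)) (fun i => s (i + 1))
    refine ⟨fun i => Nat.casesOn i (β 0 + c 1 * A 0 + s 1 * A 1) A, h0, h1, ?_⟩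
    rintro (_ | i) hi
    · rfl
    · exact hA i (by omega)

/-- Pairing with the continuants `f` sums a backward recurrence. -/
lemma backward_recurrence_eq_sum (n : ℕ) (A β c s f : ℕ → ℤ)
    (h0 : A (n + 1) = 0) (h1 : A (n + 2) = 0)
    (hA : ∀ i ≤ n, A i = β i + c (i + 1) * A (i + 1) + s (i + 1) * A (i + 2))
    (hf0 : f 0 = 1) (hf1 : f 1 = c 1)
    (hf : ∀ i, 2 ≤ i → i ≤ n → f i = c i * f (i - 1) + s (i - 1) * f (i - 2)) :
    A 0 = ∑ i ∈ Finset.range (n + 1), f i * β i := by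
  have partial_sum : ∀ m, m + 1 ≤ n → A 0 = ∑ i ∈ Finset.range (m + 1), f i * β i +
      f (m + 1) * A (m + 1) + s (m + 1) * f m * A (m + 2) := by
    intro m
    induction m with
    | zero =>
      intro _
      simp [hA 0 (by omega), hf0, hf1]
    | succ m ih =>
      intro hm
      have hfm := hf (m + 2) (by omega) hm
      simp only [Nat.add_sub_cancel, show m + 2 - 1 = m + 1 by omega] at hfm
      rw [ih (by omega), Finset.sum_range_succ _ (m + 1), hA (m + 1) (by omega), hfm]
      ring
  rcases n with _ | n
  · simp [hA 0 le_rfl, h0, h1, hf0]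
  · rw [partial_sum n le_rfl, Finset.sum_range_succ _ (n + 1), hA (n + 1) le_rfl, h0, h1]
    ring

/-- Along a division algorithm ending with `γ (n + 1) = 0`, the backward recurrence solves the
equations `r (i + 1) * A i = γ i + r i * A (i + 1)` with reduced values. -/
lemma backward_recurrence_mul_eq (n : ℕ) (r γ c β s A : ℕ → ℤ)
    (hrec : ∀ i ≤ n, r i = c (i + 1) * r (i + 1) + s (i + 1) * r (i + 2))
    (hpos : ∀ i ≤ n, 0 < r (i + 1))
    (hγrec : ∀ i ≤ n, γ i = β i * r (i + 1) - s (i + 1) * γ (i + 1))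
    (hγ : ∀ i ≤ n, 0 ≤ γ i ∧ γ i < r i) (hterm : γ (n + 1) = 0)
    (h0 : A (n + 1) = 0) (h1 : A (n + 2) = 0)
    (hA : ∀ i ≤ n, A i = β i + c (i + 1) * A (i + 1) + s (i + 1) * A (i + 2))
    (i : ℕ) (hi : i ≤ n) :
    r (i + 1) * A i = γ i + r i * A (i + 1) ∧ 0 ≤ A i ∧ A i < r i := by
  have bounds : ∀ j ≤ n, 0 ≤ A (j + 1) → A (j + 1) < r (j + 1) →
      r (j + 1) * A j = γ j + r j * A (j + 1) → 0 ≤ A j ∧ A j < r j := by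
    intro j hj hlo hhi h
    have hr := hpos j hj
    obtain ⟨hγ0, hγr⟩ := hγ j hj
    have hrj : 0 < r j := by omega
    constructor
    · refine nonneg_of_mul_nonneg_right (a := r (j + 1)) ?_ hr
      rw [h]
      positivity
    · refine lt_of_mul_lt_mul_left (a := r (j + 1)) ?_ hr.le
      rw [h]
      nlinarith
  induction hi using Nat.decreasingInduction with
  | self =>
    have h : r (n + 1) * A n = γ n + r n * A (n + 1) := by
      rw [hA n le_rfl, hγrec n le_rfl, hterm, h0, h1]
      ring
    exact ⟨h, bounds n le_rfl h0.ge (h0 ▸ hpos n le_rfl) h⟩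
  | of_succ k hk ih =>
    obtain ⟨hmul, hlo, hhi⟩ := ih
    have h : r (k + 1) * A k = γ k + r k * A (k + 1) := by
      linear_combination r (k + 1) * hA k hk.le - hγrec k hk.le - A (k + 1) * hrec k hk.le -
        s (k + 1) * hmul
    exact ⟨h, bounds k hk.le hlo hhi h⟩

/-- Extended Modular Inverse Formula, convergent form.  Indexing is shifted by one for `r`:
the Lean value `r j` is the paper's `r_{j-1}`, so `r 0 = r₋₁ = p`, `r 1 = r₀ = q`; `γ i`,
`β i`, `c i`, `s i`, `f i` carry the paper's indices.  If the generalized division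
algorithm terminates (`rₙ = 1` or `γₙ₊₁ = 0`), then the extended modular inverse
`x = (a(q⁻¹)_p)_p` satisfies `x = Σ_{i=0}^{n} fᵢ·βᵢ`. -/
theorem ext_inverse_convergent_formula (p q a : ℤ) (n : ℕ) (r γ c β s f : ℕ → ℤ) (x : ℤ)
    (hq : 1 < q) (hp : q < p) (ha0 : 0 ≤ a) (hap : a < p) (hpq : Int.gcd p q = 1)
    (hs : ∀ i, 1 ≤ i → i ≤ n + 1 → s i = 1 ∨ s i = -1)
    (hr0 : r 0 = p) (hr1 : r 1 = q) (hγ0 : γ 0 = a)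
    (hrec : ∀ i ≤ n, r i = c (i + 1) * r (i + 1) + s (i + 1) * r (i + 2) ∧
      0 ≤ r (i + 2) ∧ r (i + 2) < r (i + 1))
    (hγrec : ∀ i ≤ n, γ i = β i * r (i + 1) - s (i + 1) * γ (i + 1) ∧
      0 ≤ γ (i + 1) ∧ γ (i + 1) < r (i + 1))
    (hf0 : f 0 = 1) (hf1 : f 1 = c 1)
    (hf : ∀ i, 2 ≤ i → i ≤ n → f i = c i * f (i - 1) + s (i - 1) * f (i - 2))
    (hterm : r (n + 1) = 1 ∨ γ (n + 1) = 0)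
    (hx0 : 0 ≤ x) (hxp : x < p) (hx : q * x ≡ a [ZMOD p]) :
    x = ∑ i ∈ Finset.range (n + 1), f i * β i := by
  have hpos : ∀ i ≤ n, 0 < r (i + 1) := fun i hi => (hrec i hi).2.1.trans_lt (hrec i hi).2.2
  have hγ : ∀ i ≤ n, 0 ≤ γ i ∧ γ i < r i := by
    rintro (_ | i) hi
    · rw [hγ0, hr0]
      exact ⟨ha0, hap⟩
    · exact (hγrec i (by omega)).2
  have hγn : γ (n + 1) = 0 := by
    have := (hγrec n le_rfl).2
    omega
  obtain ⟨A, h0, h1, hA⟩ := exists_backward_recurrence (n + 1) β c s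
  replace hA : ∀ i ≤ n, A i = β i + c (i + 1) * A (i + 1) + s (i + 1) * A (i + 2) :=
    fun i hi => hA i (by omega)
  obtain ⟨hmul, hlo, hhi⟩ := backward_recurrence_mul_eq n r γ c β s A (fun i hi => (hrec i hi).1)
    hpos (fun i hi => (hγrec i hi).1) hγ hγn h0 h1 hA 0 n.zero_le
  rw [zero_add, hr1, hγ0, hr0] at hmul
  rw [hr0] at hhi
  rw [← backward_recurrence_eq_sum n A β c s f h0 h1 hA hf0 hf1 hf]
  have hmod : x ≡ A 0 [ZMOD p] := by
    have h : q * x ≡ q * A 0 [ZMOD p] :=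
      hx.trans (by rw [hmul]; exact (Int.modEq_iff_dvd.2 ⟨A 1, by ring⟩))
    simpa [hpq] using h.cancel_left_div_gcd (by omega)
  rwa [Int.ModEq, Int.emod_eq_of_lt hx0 hxp, Int.emod_eq_of_lt hlo hhi] at hmod
end

section
/- Modular Inverse Formula (first type): let p, q be coprime integers with 1 < q < p. Define r_{−1} = p, r_0 = q and r_{i+1} = (r_{i−1})_{r_i} (the ordinary Euclidean remainders), and let n ≥ 0 be such that r_n = 1 and r_i > 1 for 0 ≤ i < n. Then the modular inverse satisfies, as rational numbers, (q⁻¹)_p = p·Σ_{i=0}^{n} (−1)^i/(r_{i−1}·r_i) + E, where E = 0 if n is even and E = p if n is odd. -/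
/-- Along a Euclidean remainder sequence of positive integers ending in `1`, the alternating sum of
reciprocals of products of consecutive terms, suitably shifted, is a representative in `[1, r 0]`
of the inverse of `r 1` modulo `r 0`. -/
theorem exists_inverse_eq_alternating_sum (n : ℕ) (r : ℕ → ℤ)
    (hrec : ∀ i < n, r (i + 2) = r i % r (i + 1))
    (hpos : ∀ i ≤ n, 0 < r i) (hrn : r (n + 1) = 1) :
    ∃ y : ℤ, 1 ≤ y ∧ y ≤ r 0 ∧ r 0 ∣ r 1 * y - 1 ∧
      (y : ℚ) = (r 0 : ℚ) * (∑ i ∈ Finset.range (n + 1),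
        (-1 : ℚ) ^ i / ((r i : ℚ) * (r (i + 1) : ℚ))) +
      (if Even n then 0 else (r 0 : ℚ)) := by
  induction n generalizing r with
  | zero =>
    have h0 : 0 < r 0 := hpos 0 le_rfl
    have h1 : r 1 = 1 := hrn
    have h0' : (r 0 : ℚ) ≠ 0 := by exact_mod_cast h0.ne'
    exact ⟨1, le_rfl, h0, by simp [h1], by simp [h1, h0']⟩
  | succ n ih =>
    obtain ⟨y, hy1, hyq, hdvd, hy⟩ := ih (fun i => r (i + 1))
      (fun i hi => hrec (i + 1) (by lia)) (fun i hi => hpos (i + 1) (by lia)) hrn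
    have hp : 0 < r 0 := hpos 0 (by lia)
    have hq : 0 < r 1 := hpos 1 (by lia)
    have h2 : r 2 = r 0 % r 1 := hrec 0 (by lia)
    simp only [zero_add, Nat.reduceAdd] at hyq hdvd hy
    obtain ⟨k, hk⟩ : r 1 ∣ r 0 * y - 1 := by
      have h : r 0 * y - 1 = r 1 * (r 0 / r 1 * y) + (r 2 * y - 1) := by
        rw [h2]
        linear_combination (-y) * Int.mul_ediv_add_emod (r 0) (r 1)
      rw [h]
      exact dvd_add (dvd_mul_right _ _) hdvd
    have hz : r 1 * (r 0 - k) = 1 + r 0 * (r 1 - y) := by linear_combination hk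
    refine ⟨r 0 - k, ?_, ?_, ⟨r 1 - y, by linear_combination hz⟩, ?_⟩
    · have : 0 < r 1 * (r 0 - k) := by
        rw [hz]
        have := mul_nonneg hp.le (sub_nonneg.2 hyq)
        lia
      exact pos_of_mul_pos_right this hq.le
    · have : 0 ≤ r 1 * k := by
        rw [← hk]
        nlinarith
      have := nonneg_of_mul_nonneg_right this hq
      lia
    · have hp' : (r 0 : ℚ) ≠ 0 := by exact_mod_cast hp.ne'
      have hq' : (r 1 : ℚ) ≠ 0 := by exact_mod_cast hq.ne'
      have hkq : (r 0 : ℚ) * y - 1 = r 1 * k := by exact_mod_cast hk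
      rw [Finset.sum_range_succ']
      simp only [pow_succ, mul_neg_one, neg_div, Finset.sum_neg_distrib, pow_zero, zero_add]
      set S := ∑ i ∈ Finset.range (n + 1),
        (-1 : ℚ) ^ i / ((r (i + 1) : ℚ) * (r (i + 1 + 1) : ℚ))
      push_cast
      by_cases hn : Even n
      · simp only [hn, if_true, Nat.even_add_one, not_true_eq_false, if_false] at hy ⊢
        field_simp
        linear_combination hkq - (r 0 : ℚ) * hy
      · simp only [hn, if_false, Nat.even_add_one, not_false_eq_true, if_true] at hy ⊢
        field_simp
        linear_combination hkq - (r 0 : ℚ) * hy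

/-- Modular Inverse Formula, first type.  Indexing shifted by one: the Lean value `r j` is
the paper's `r_{j-1}`, so `r 0 = p`, `r 1 = q`, `r (i+2) = (r_{i-1})_{r_i}` are the
ordinary Euclidean remainders, and `r (n+1) = r_n = 1`.  Then, in `ℚ`,
`(q⁻¹)_p = p·Σ_{i=0}^{n} (−1)^i/(r_{i-1}·r_i) + E` with `E = 0` for even `n`, `E = p` for
odd `n`. -/
theorem modular_inverse_formula_first (p q : ℤ) (n : ℕ) (r : ℕ → ℤ) (x : ℤ)
    (hq : 1 < q) (hp : q < p) (hpq : Int.gcd p q = 1)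
    (hr0 : r 0 = p) (hr1 : r 1 = q)
    (hrec : ∀ i < n, r (i + 2) = r i % r (i + 1))
    (hrn : r (n + 1) = 1)
    (hbig : ∀ i < n, 1 < r (i + 1))
    (hx1 : 1 ≤ x) (hx2 : x ≤ p - 1) (hx : q * x ≡ 1 [ZMOD p]) :
    (x : ℚ) = (p : ℚ) * (∑ i ∈ Finset.range (n + 1),
        (-1 : ℚ) ^ i / ((r i : ℚ) * (r (i + 1) : ℚ))) +
      (if Even n then 0 else (p : ℚ)) := by
  have hpos : ∀ i ≤ n, 0 < r i := by
    rintro (_ | i) hi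
    · lia
    · have := hbig i hi
      lia
  obtain ⟨y, hy1, hyp, hdvd, hy⟩ := exists_inverse_eq_alternating_sum n r hrec hpos hrn
  rw [hr0] at hyp hdvd hy
  rw [hr1] at hdvd
  suffices x = y by rw [this, hy]
  have hmul : p ∣ q * (x - y) := by
    have := dvd_sub hx.symm.dvd hdvd
    rwa [show q * x - 1 - (q * y - 1) = q * (x - y) by ring] at this
  have hsub : p ∣ x - y := Int.dvd_of_dvd_mul_right_of_gcd_one hmul hpq
  have := Int.eq_zero_of_abs_lt_dvd hsub (abs_lt.2 ⟨by lia, by lia⟩)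
  lia
end

section
/- Modular Inverse Formula (second type): let p, q be coprime integers with 1 < q < p. Define r_{−1} = p, r_0 = q and r_{i+1} = (−r_{i−1})_{r_i} (the negative-remainder division steps), and let n ≥ 0 be such that r_n = 1 and r_i > 1 for 0 ≤ i < n. Then the modular inverse satisfies, as rational numbers, (q⁻¹)_p = p·Σ_{i=0}^{n} 1/(r_{i−1}·r_i). -/
/-- For a sequence `r` of negative-remainder division steps ending in `1`, the number
`r 0 * ∑ 1 / (r i * r (i + 1))` is an integer in `[1, r 0)` inverting `r 1` modulo `r 0`. -/
theorem exists_inverse_eq_sum_of_negRemainder (n : ℕ) (r : ℕ → ℤ)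
    (hlt : r 1 < r 0)
    (hrec : ∀ i < n, r (i + 2) = (-(r i)) % r (i + 1))
    (hrn : r (n + 1) = 1)
    (hbig : ∀ i < n, 1 < r (i + 1)) :
    ∃ y : ℤ, 1 ≤ y ∧ y < r 0 ∧ r 0 ∣ r 1 * y - 1 ∧
      (y : ℚ) = (r 0 : ℚ) * ∑ i ∈ Finset.range (n + 1),
        1 / ((r i : ℚ) * (r (i + 1) : ℚ)) := by
  induction n generalizing r with
  | zero =>
    simp only [zero_add] at hrn
    have h0 : (r 0 : ℚ) ≠ 0 := by
      have : r 0 ≠ 0 := by omega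
      exact_mod_cast this
    refine ⟨1, le_rfl, by omega, by simp [hrn], ?_⟩
    simp [hrn, h0]
  | succ n ih =>
    have h1 : 1 < r 1 := hbig 0 n.succ_pos
    have h2 : r 2 = (-(r 0)) % r 1 := hrec 0 n.succ_pos
    have h21 : r 2 < r 1 := h2 ▸ Int.emod_lt_of_pos _ (by omega)
    obtain ⟨z, hz1, hz2, hzd, hz⟩ := ih (fun i => r (i + 1)) h21
      (fun i hi => hrec (i + 1) (by omega)) hrn (fun i hi => hbig (i + 1) (by omega))
    simp only [zero_add, one_add_one_eq_two] at hz2 hzd hz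
    have hdvd : r 1 ∣ 1 + r 0 * z := by
      have h : r 1 ∣ r 2 + r 0 := by
        have := Int.dvd_self_sub_emod (x := -(r 0)) (m := r 1)
        rw [← h2] at this
        rwa [← dvd_neg, show -(-(r 0) - r 2) = r 2 + r 0 by ring] at this
      have := (h.mul_right z).sub hzd
      rwa [show (r 2 + r 0) * z - (r 2 * z - 1) = 1 + r 0 * z by ring] at this
    obtain ⟨y, hy⟩ := hdvd
    refine ⟨y, ?_, ?_, ⟨z, by linarith⟩, ?_⟩
    · have : 0 < r 1 * y := by
        rw [← hy]
        have : 0 < r 0 * z := mul_pos (by omega) (by omega)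
        omega
      exact pos_of_mul_pos_right this (by omega)
    · have : r 1 * y < r 1 * r 0 := by nlinarith
      exact lt_of_mul_lt_mul_left this (by omega)
    · have h0q : (r 0 : ℚ) ≠ 0 := by
        have : r 0 ≠ 0 := by omega
        exact_mod_cast this
      have h1q : (r 1 : ℚ) ≠ 0 := by
        have : r 1 ≠ 0 := by omega
        exact_mod_cast this
      have hyq : 1 + (r 0 : ℚ) * z = r 1 * y := by exact_mod_cast hy
      rw [Finset.sum_range_succ']
      apply mul_left_cancel₀ h1q
      rw [← hyq, hz]
      simp only [zero_add]
      field_simp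
      ring

/-- Modular Inverse Formula, second type.  Indexing shifted by one: the Lean value `r j`
is the paper's `r_{j-1}`, so `r 0 = p`, `r 1 = q`, `r (i+2) = (−r_{i-1})_{r_i}` are the
negative-remainder division steps, and `r (n+1) = r_n = 1`.  Then, in `ℚ`,
`(q⁻¹)_p = p·Σ_{i=0}^{n} 1/(r_{i-1}·r_i)`. -/
theorem modular_inverse_formula_second (p q : ℤ) (n : ℕ) (r : ℕ → ℤ) (x : ℤ)
    (hq : 1 < q) (hp : q < p) (hpq : Int.gcd p q = 1)
    (hr0 : r 0 = p) (hr1 : r 1 = q)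
    (hrec : ∀ i < n, r (i + 2) = (-(r i)) % r (i + 1))
    (hrn : r (n + 1) = 1)
    (hbig : ∀ i < n, 1 < r (i + 1))
    (hx1 : 1 ≤ x) (hx2 : x ≤ p - 1) (hx : q * x ≡ 1 [ZMOD p]) :
    (x : ℚ) = (p : ℚ) * (∑ i ∈ Finset.range (n + 1),
        1 / ((r i : ℚ) * (r (i + 1) : ℚ))) := by
  obtain ⟨y, hy1, hy2, hyd, hy⟩ := exists_inverse_eq_sum_of_negRemainder n r
    (by omega) hrec hrn hbig
  rw [hr0] at hy2 hyd hy
  rw [hr1] at hyd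
  have hxd : p ∣ q * x - 1 := hx.symm.dvd
  have hd : p ∣ x - y := by
    have h : p ∣ q * (x - y) := by
      rw [show q * (x - y) = q * x - 1 - (q * y - 1) by ring]
      exact hxd.sub hyd
    exact Int.dvd_of_dvd_mul_right_of_gcd_one h hpq
  have hxy : x - y = 0 := Int.eq_zero_of_abs_lt_dvd hd (by rw [abs_lt]; omega)
  rw [← hy, sub_eq_zero.mp hxy]
end

section
/- Extended inverses of the remainders: let p, q be coprime integers with 1 < q < p. Define r_{−1} = p, r_0 = q, r_{i+1} = (−r_{i−1})_{r_i}, and c_{i+1} = ⌈r_{i−1}/r_i⌉, and let n ≥ 0 be such that r_n = 1 and r_i > 1 for 0 ≤ i < n. Define f_0 = 1, f_1 = c_1, and f_i = c_i·f_{i−1} − f_{i−2} for 2 ≤ i ≤ n. Then for every 0 ≤ j ≤ n: 0 ≤ f_j < p and q·f_j ≡ r_j (mod p); that is, (r_j·(q⁻¹)_p)_p = f_j. -/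
theorem Int.neg_emod_eq_ceil_div_mul_sub {a b : ℤ} (hb : 0 < b) :
    (-a) % b = ⌈(a : ℚ) / (b : ℚ)⌉ * b - a := by
  have hb' : (0 : ℚ) < b := by exact_mod_cast hb
  have hceil : ⌈(a : ℚ) / (b : ℚ)⌉ = -((-a) / b) := by
    rw [Int.ceil_eq_iff, lt_div_iff₀ hb', div_le_iff₀ hb']
    have h₁ := Int.emod_add_mul_ediv (-a) b
    have h₂ := Int.emod_nonneg (-a) hb.ne'
    have h₃ := Int.emod_lt_of_pos (-a) hb
    constructor
    · have : (-((-a) / b) - 1) * b < a := by linarith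
      exact_mod_cast this
    · have : a ≤ -((-a) / b) * b := by linarith
      exact_mod_cast this
  rw [hceil]
  linarith [Int.emod_add_mul_ediv (-a) b]


/-- Extended inverses of the remainders.  Indexing shifted by one for `r`: the Lean value
`r j` is the paper's `r_{j-1}`, so `r 0 = p`, `r 1 = q`, `r (i+2) = (−r_{i-1})_{r_i}`,
`c (i+1) = ⌈r_{i-1}/r_i⌉`, `r (n+1) = r_n = 1`; `f` carries the paper's indices with
`f 0 = 1`, `f 1 = c 1`, `f i = c i·f (i-1) − f (i-2)`.  Then for every `0 ≤ j ≤ n`,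
`0 ≤ f j < p` and `q·f j ≡ r_j (mod p)`, i.e. `(r_j·(q⁻¹)_p)_p = f j`. -/
theorem ext_inverse_of_remainders (p q : ℤ) (n : ℕ) (r c f : ℕ → ℤ)
    (hq : 1 < q) (hp : q < p) (hpq : Int.gcd p q = 1)
    (hr0 : r 0 = p) (hr1 : r 1 = q)
    (hrec : ∀ i < n, r (i + 2) = (-(r i)) % r (i + 1))
    (hc : ∀ i < n, c (i + 1) = ⌈((r i : ℚ)) / ((r (i + 1) : ℚ))⌉)
    (hrn : r (n + 1) = 1)
    (hbig : ∀ i < n, 1 < r (i + 1))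
    (hf0 : f 0 = 1) (hf1 : f 1 = c 1)
    (hf : ∀ i, 2 ≤ i → i ≤ n → f i = c i * f (i - 1) - f (i - 2)) :
    ∀ j ≤ n, 0 ≤ f j ∧ f j < p ∧ q * f j ≡ r (j + 1) [ZMOD p] := by
  have hpos : ∀ i ≤ n, 0 < r (i + 1) := by
    intro i hi
    rcases hi.lt_or_eq with h | rfl
    · linarith [hbig i h]
    · omega
  have hstep : ∀ i < n, r (i + 2) = c (i + 1) * r (i + 1) - r i := fun i hi => by
    rw [hrec i hi, hc i hi, Int.neg_emod_eq_ceil_div_mul_sub (hpos i hi.le)]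
  have hlt : ∀ i < n, r (i + 2) < r (i + 1) := fun i hi => by
    rw [hrec i hi]
    exact Int.emod_lt_of_pos _ (hpos i hi.le)
  have hdecr : ∀ i ≤ n, r (i + 1) < r i := by
    rintro (_ | i) hi
    · simpa [hr0, hr1] using hp
    · exact hlt i hi
  have hc2 : ∀ i < n, 2 ≤ c (i + 1) := by
    intro i hi
    have h₁ := hstep i hi
    have h₂ := hpos (i + 1) hi
    have h₃ := hpos i hi.le
    have h₄ := hdecr i hi.le
    by_contra! h
    nlinarith
  have key : ∀ i < n, 0 < f i ∧ f i < f (i + 1) ∧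
      f (i + 1) * r (i + 1) - f i * r (i + 2) = p ∧
      p ∣ r (i + 1) - q * f i ∧ p ∣ r (i + 2) - q * f (i + 1) := by
    intro i
    induction i with
    | zero =>
      intro hi
      have h₁ := hstep 0 hi
      have h₂ := hc2 0 hi
      simp only [zero_add, hr0, hr1] at h₁ h₂ ⊢
      rw [hf0, hf1, h₁]
      exact ⟨one_pos, by linarith, by ring, ⟨0, by ring⟩, ⟨-1, by ring⟩⟩
    | succ i ih =>
      intro hi
      obtain ⟨h₁, h₂, h₃, h₄, h₅⟩ := ih (by omega)
      have hr' : r (i + 3) = c (i + 2) * r (i + 2) - r (i + 1) := hstep (i + 1) hi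
      have hf' : f (i + 2) = c (i + 2) * f (i + 1) - f i := hf (i + 2) (by omega) hi
      have hc' : 2 ≤ c (i + 2) := hc2 (i + 1) hi
      change 0 < f (i + 1) ∧ f (i + 1) < f (i + 2) ∧
        f (i + 2) * r (i + 2) - f (i + 1) * r (i + 3) = p ∧
        p ∣ r (i + 2) - q * f (i + 1) ∧ p ∣ r (i + 3) - q * f (i + 2)
      rw [hr', hf']
      refine ⟨by linarith, by nlinarith, by linarith, h₅, ?_⟩
      have h₆ := (h₅.mul_left (c (i + 2))).sub h₄
      ring_nf at h₆ ⊢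
      exact h₆
  rintro (_ | i) hj
  · rw [hf0, zero_add, hr1, mul_one]
    exact ⟨zero_le_one, by linarith, Int.ModEq.refl q⟩
  · obtain ⟨h₁, h₂, h₃, -, h₅⟩ := key i hj
    have h₆ : 0 < r (i + 2) := hpos (i + 1) hj
    have h₇ := hlt i hj
    exact ⟨by linarith, by nlinarith, Int.modEq_iff_dvd.mpr h₅⟩
end
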